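/- Let ρ_ABC be a three-qubit density matrix and fix an orthonormal basis {|v₁⟩,…,|v₄⟩} of ℂ²⊗ℂ² defining a rank-one projective measurement on subsystems AB. Then the change in the cost of state merging caused by the two-particle measurement is nonnegative: Δ₂ := S(ρ_{C|Π^{AB}}) − (S(ρ_ABC) − S(ρ_AB)) ≥ 0; that is, discarding the prior information held in AB through a projective measurement cannot decrease the conditional entropy S(C|AB). -/

import Mathlib

open scoped BigOperators ComplexOrder
open Matrix

noncomputable section

abbrev Q2 := Fin 2
abbrev Q4 := Fin 2 × Fin 2
abbrev Q3 := Fin 2 × Fin 2 × Fin 2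

/-- A density matrix: positive semidefinite (hence Hermitian) with unit trace. -/
def IsDensityMatrix {n : Type*} [Fintype n] [DecidableEq n] (ρ : Matrix n n ℂ) : Prop :=
  ρ.PosSemidef ∧ ρ.trace = 1

/-- Von Neumann entropy `S(ρ) = -∑ λᵢ log λᵢ` (eigenvalues of a Hermitian matrix),
with the convention `0 log 0 = 0`. -/
noncomputable def vN {n : Type*} [Fintype n] [DecidableEq n] (ρ : Matrix n n ℂ) : ℝ :=
  if h : ρ.IsHermitian then ∑ i, Real.negMulLog (h.eigenvalues i) else 0

/-- Rank-one projector `|u⟩⟨u|`. -/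
def proj {n : Type*} (u : n → ℂ) : Matrix n n ℂ := fun i j => u i * star (u j)

/-- An orthonormal family of vectors (an orthonormal basis when `card ι = card n`). -/
def OrthonormalFamily {ι n : Type*} [DecidableEq ι] [Fintype n] (u : ι → n → ℂ) : Prop :=
  ∀ i j, (∑ k, star (u i k) * u j k) = if i = j then (1 : ℂ) else 0

/-- A unit vector. -/
def IsUnitVec {n : Type*} [Fintype n] (u : n → ℂ) : Prop :=
  (∑ k, star (u k) * u k) = 1

/-- Reduced state of subsystem A. -/
def rhoA (ρ : Matrix Q3 Q3 ℂ) : Matrix Q2 Q2 ℂ := fun a a' => ∑ b, ∑ c, ρ (a, b, c) (a', b, c)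
/-- Reduced state of subsystem B. -/
def rhoB (ρ : Matrix Q3 Q3 ℂ) : Matrix Q2 Q2 ℂ := fun b b' => ∑ a, ∑ c, ρ (a, b, c) (a, b', c)
/-- Reduced state of subsystem C. -/
def rhoC (ρ : Matrix Q3 Q3 ℂ) : Matrix Q2 Q2 ℂ := fun c c' => ∑ a, ∑ b, ρ (a, b, c) (a, b, c')
/-- Reduced state of subsystems AB. -/
def rhoAB (ρ : Matrix Q3 Q3 ℂ) : Matrix Q4 Q4 ℂ := fun x y => ∑ c, ρ (x.1, x.2, c) (y.1, y.2, c)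
/-- Reduced state of subsystems BC. -/
def rhoBC (ρ : Matrix Q3 Q3 ℂ) : Matrix Q4 Q4 ℂ := fun x y => ∑ a, ρ (a, x.1, x.2) (a, y.1, y.2)
/-- Reduced state of subsystems AC. -/
def rhoAC (ρ : Matrix Q3 Q3 ℂ) : Matrix Q4 Q4 ℂ := fun x y => ∑ b, ρ (x.1, b, x.2) (y.1, b, y.2)

/-- `I ⊗ π ⊗ I`: an operator acting on subsystem B only. -/
def opB (π : Matrix Q2 Q2 ℂ) : Matrix Q3 Q3 ℂ :=
  fun x y => (if x.1 = y.1 then (1 : ℂ) else 0) * π x.2.1 y.2.1 *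
    (if x.2.2 = y.2.2 then (1 : ℂ) else 0)

/-- `π ⊗ I`: an operator acting on subsystems AB only. -/
def opAB (π : Matrix Q4 Q4 ℂ) : Matrix Q3 Q3 ℂ :=
  fun x y => π (x.1, x.2.1) (y.1, y.2.1) * (if x.2.2 = y.2.2 then (1 : ℂ) else 0)

/-- Outcome probability `pⱼ = Tr((I⊗πⱼ⊗I)ρ)` for measurement of B in basis `u`. -/
def pB (ρ : Matrix Q3 Q3 ℂ) (u : Fin 2 → Q2 → ℂ) (j : Fin 2) : ℝ :=
  ((opB (proj (u j)) * ρ).trace).re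

/-- Conditional state of A given outcome `j` of the measurement on B. -/
def condA (ρ : Matrix Q3 Q3 ℂ) (u : Fin 2 → Q2 → ℂ) (j : Fin 2) : Matrix Q2 Q2 ℂ :=
  ((pB ρ u j : ℂ))⁻¹ • rhoA (opB (proj (u j)) * ρ * opB (proj (u j)))

/-- Average conditional entropy `S(ρ_{A|Π^B}) = ∑_{j : pⱼ>0} pⱼ S(ρ_{A|j})`. -/
def SAcondB (ρ : Matrix Q3 Q3 ℂ) (u : Fin 2 → Q2 → ℂ) : ℝ :=
  ∑ j, if 0 < pB ρ u j then pB ρ u j * vN (condA ρ u j) else 0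

/-- Outcome probability `pⱼ = Tr((πⱼ⊗I)ρ)` for measurement of AB in basis `v`. -/
def pAB (ρ : Matrix Q3 Q3 ℂ) (v : Fin 4 → Q4 → ℂ) (j : Fin 4) : ℝ :=
  ((opAB (proj (v j)) * ρ).trace).re

/-- Conditional state of C given outcome `j` of the measurement on AB. -/
def condC (ρ : Matrix Q3 Q3 ℂ) (v : Fin 4 → Q4 → ℂ) (j : Fin 4) : Matrix Q2 Q2 ℂ :=
  ((pAB ρ v j : ℂ))⁻¹ • rhoC (opAB (proj (v j)) * ρ * opAB (proj (v j)))

/-- Average conditional entropy `S(ρ_{C|Π^{AB}}) = ∑_{j : pⱼ>0} pⱼ S(ρ_{C|j})`. -/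
def SCcondAB (ρ : Matrix Q3 Q3 ℂ) (v : Fin 4 → Q4 → ℂ) : ℝ :=
  ∑ j, if 0 < pAB ρ v j then pAB ρ v j * vN (condC ρ v j) else 0

/-- `𝓘₀(A:B:C)`: mutual information with no measurement. -/
def I0 (ρ : Matrix Q3 Q3 ℂ) : ℝ :=
  vN (rhoA ρ) + vN (rhoB ρ) + vN (rhoC ρ)
    - (vN (rhoAB ρ) + vN (rhoBC ρ) + vN (rhoAC ρ)) + vN ρ

/-- `𝓘₁(A:B:C)`: mutual information after one-particle measurement on B. -/
def I1 (ρ : Matrix Q3 Q3 ℂ) (u : Fin 2 → Q2 → ℂ) : ℝ :=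
  vN (rhoA ρ) + vN (rhoC ρ) - SAcondB ρ u - vN (rhoAC ρ) - vN (rhoBC ρ) + vN ρ

/-- `𝓘₂(A:B:C)`: mutual information after two-particle measurement on AB. -/
def I2 (ρ : Matrix Q3 Q3 ℂ) (v : Fin 4 → Q4 → ℂ) : ℝ :=
  vN (rhoA ρ) + vN (rhoB ρ) + vN (rhoC ρ) - (vN (rhoBC ρ) + vN (rhoAC ρ)) + SCcondAB ρ v

/-- Residual correlation function `D_RC = 𝓘₂ - 𝓘₁`. -/
def DRC (ρ : Matrix Q3 Q3 ℂ) (u : Fin 2 → Q2 → ℂ) (v : Fin 4 → Q4 → ℂ) : ℝ :=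
  I2 ρ v - I1 ρ u

open Filter Topology

/-- An inequality between the resolvent sums of two weighted families integrates to an inequality
between their relative entropies. -/
lemma sum_mul_log_div_le_of_resolvent_le {κ m : Type*} [Fintype κ] [Fintype m]
    (w a b : κ → ℝ) (c d : m → ℝ)
    (ha : ∀ k, 0 ≤ a k) (hb : ∀ k, 0 ≤ b k) (hc : ∀ k, 0 ≤ c k) (hd : ∀ k, 0 ≤ d k)
    (hab : ∀ k, b k = 0 → w k * a k = 0) (hcd : ∀ k, d k = 0 → c k = 0)
    (hsum : ∑ k, w k * a k = ∑ k, c k)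
    (hres : ∀ t : ℝ, 0 < t →
      ∑ k, c k ^ 2 / (d k + t * c k) ≤ ∑ k, w k * (a k ^ 2 / (b k + t * a k))) :
    ∑ k, c k * (Real.log (c k) - Real.log (d k)) ≤
      ∑ k, w k * a k * (Real.log (a k) - Real.log (b k)) := by
  set Φ : ℝ → ℝ := fun t => ∑ k, w k * a k * Real.log (b k + t * a k)
    - ∑ k, c k * Real.log (d k + t * c k) with hΦ
  have hderiv1 : ∀ k, ∀ t : ℝ, 0 ≤ t → HasDerivAt (fun t => w k * a k * Real.log (b k + t * a k))
      (w k * (a k ^ 2 / (b k + t * a k))) t := by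
    intro k t ht
    rcases (hb k).eq_or_lt with h | h
    · have h0 := hab k h.symm
      have h1 : w k * (a k ^ 2 / (b k + t * a k)) = 0 := by
        rw [mul_div_assoc', pow_two, ← mul_assoc, h0]; simp
      simp only [h0, h1, zero_mul]
      exact hasDerivAt_const _ _
    · have hpos : 0 < b k + t * a k := by have := mul_nonneg ht (ha k); linarith
      have := ((((hasDerivAt_id t).mul_const (a k)).const_add (b k)).log hpos.ne').const_mul
        (w k * a k)
      refine this.congr_deriv ?_
      simp only [id_eq]
      ring
  have hderiv2 : ∀ k, ∀ t : ℝ, 0 ≤ t → HasDerivAt (fun t => c k * Real.log (d k + t * c k))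
      (c k ^ 2 / (d k + t * c k)) t := by
    intro k t ht
    rcases (hd k).eq_or_lt with h | h
    · have h0 := hcd k h.symm
      simp only [h0, zero_mul]
      exact (hasDerivAt_const t (0 : ℝ)).congr_deriv (by simp)
    · have hpos : 0 < d k + t * c k := by have := mul_nonneg ht (hc k); linarith
      have := ((((hasDerivAt_id t).mul_const (c k)).const_add (d k)).log hpos.ne').const_mul (c k)
      refine this.congr_deriv ?_
      simp only [id_eq]
      ring
  have hΦd : ∀ t : ℝ, 0 ≤ t → HasDerivAt Φ (∑ k, w k * (a k ^ 2 / (b k + t * a k))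
      - ∑ k, c k ^ 2 / (d k + t * c k)) t := fun t ht =>
    (HasDerivAt.fun_sum fun k _ => hderiv1 k t ht).sub
      (HasDerivAt.fun_sum fun k _ => hderiv2 k t ht)
  have hmono : MonotoneOn Φ (Set.Ici 0) := by
    refine monotoneOn_of_deriv_nonneg (convex_Ici 0)
      (fun t ht => (hΦd t ht).continuousAt.continuousWithinAt) ?_ ?_
    · intro t ht
      rw [interior_Ici] at ht
      exact (hΦd t (le_of_lt ht)).differentiableAt.differentiableWithinAt
    · intro t ht
      rw [interior_Ici] at ht
      rw [(hΦd t (le_of_lt ht)).deriv]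
      exact sub_nonneg.2 (hres t ht)
  have hlog : ∀ p q t : ℝ, 0 ≤ p → 0 ≤ q → 0 < t →
      p * Real.log (q + t * p) = p * Real.log t + p * Real.log (q * t⁻¹ + p) := by
    intro p q t hp hq ht
    rcases hp.eq_or_lt with rfl | hp
    · simp
    · rw [← mul_add, ← Real.log_mul ht.ne' (by positivity)]
      congr 2
      field_simp
  have hΦT : ∀ t : ℝ, 0 < t → Φ t = ∑ k, w k * (a k * Real.log (b k * t⁻¹ + a k))
      - ∑ k, c k * Real.log (d k * t⁻¹ + c k) := by
    intro t ht
    simp only [hΦ, mul_assoc, hlog _ _ t (ha _) (hb _) ht, hlog _ _ t (hc _) (hd _) ht, mul_add,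
      Finset.sum_add_distrib]
    simp only [← mul_assoc, ← Finset.sum_mul, hsum]
    ring
  have hlim1 : ∀ p q : ℝ, Tendsto (fun t : ℝ => p * Real.log (q * t⁻¹ + p)) atTop
      (𝓝 (p * Real.log p)) := by
    intro p q
    rcases eq_or_ne p 0 with rfl | hp
    · simp
    · have : Tendsto (fun t : ℝ => q * t⁻¹ + p) atTop (𝓝 p) := by
        simpa using (tendsto_inv_atTop_zero.const_mul q).add_const p
      exact (this.log hp).const_mul p
  have hlim : Tendsto Φ atTop (𝓝 (∑ k, w k * (a k * Real.log (a k))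
      - ∑ k, c k * Real.log (c k))) := by
    refine Tendsto.congr' (f₁ := fun t : ℝ => ∑ k, w k * (a k * Real.log (b k * t⁻¹ + a k))
      - ∑ k, c k * Real.log (d k * t⁻¹ + c k)) ?_ ?_
    · filter_upwards [eventually_gt_atTop 0] with t ht using (hΦT t ht).symm
    · exact (tendsto_finsetSum _ fun k _ => (hlim1 _ _).const_mul _).sub
        (tendsto_finsetSum _ fun k _ => hlim1 _ _)
  have h0 : Φ 0 ≤ _ := ge_of_tendsto hlim (by
    filter_upwards [eventually_ge_atTop 0] with t ht
    exact hmono Set.self_mem_Ici ht ht)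
  simp only [hΦ, zero_mul, add_zero] at h0
  simp only [mul_sub, Finset.sum_sub_distrib]
  simp only [← mul_assoc] at h0 ⊢
  linarith

/-- Measuring in an orthonormal basis does not increase the resolvent form. -/
lemma sum_sq_div_le_of_measurement {n ι κ m : Type*} [Fintype n] [Fintype ι] [Fintype κ]
    [Fintype m] [DecidableEq n] [DecidableEq ι] [DecidableEq κ] [DecidableEq m]
    (U : Matrix n ι ℂ) (V : Matrix n κ ℂ) (W : Matrix n m ℂ)
    (hU : U * Uᴴ = 1) (hV : V * Vᴴ = 1) (hW : Wᴴ * W = 1)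
    (a : ι → ℝ) (b : κ → ℝ) (c d : m → ℝ)
    (ha : ∀ k, 0 ≤ a k) (hb : ∀ k, 0 ≤ b k) (hc : ∀ k, 0 ≤ c k) (hd : ∀ k, 0 ≤ d k)
    (hac : ∀ k, (Wᴴ * (U * diagonal (fun i => (a i : ℂ)) * Uᴴ) * W) k k = c k)
    (hbd : ∀ k, (Wᴴ * (V * diagonal (fun i => (b i : ℂ)) * Vᴴ) * W) k k = d k)
    (t : ℝ) (ht : 0 < t) :
    ∑ k, c k ^ 2 / (d k + t * c k) ≤
      ∑ p : κ × ι, Complex.normSq ((Vᴴ * U) p.1 p.2) * (a p.2 ^ 2 / (b p.1 + t * a p.2)) := by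
  set A : Matrix ι ι ℂ := diagonal (fun i => (a i : ℂ))
  set B : Matrix κ κ ℂ := diagonal (fun i => (b i : ℂ))
  set y : m → ℝ := fun k => c k / (d k + t * c k)
  set D : Matrix m m ℂ := diagonal (fun i => (y i : ℂ))
  set Y : Matrix n n ℂ := W * D * Wᴴ
  have hD : Dᴴ = D := by
    ext i j; simp [D, diagonal_apply]; split_ifs with h <;> simp_all
  have hY : Yᴴ = Y := by simp [Y, Matrix.mul_assoc, hD]
  set Z := Vᴴ * Y * U
  have hterm : ∀ p : κ × ι, 2 * (a p.2 * (star ((Vᴴ * U) p.1 p.2) * Z p.1 p.2).re)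
      - b p.1 * Complex.normSq (Z p.1 p.2) - t * (a p.2 * Complex.normSq (Z p.1 p.2)) ≤
      Complex.normSq ((Vᴴ * U) p.1 p.2) * (a p.2 ^ 2 / (b p.1 + t * a p.2)) := by
    rintro ⟨j, i⟩
    generalize (Vᴴ * U) j i = x
    generalize Z j i = z
    have hai := ha i
    have hbj := hb j
    have hta := mul_nonneg ht.le hai
    dsimp only
    rcases (add_nonneg hbj hta).eq_or_lt with h | h
    · have h1 : b j = 0 := by linarith
      have h2 : a i = 0 := by
        have : t * a i = 0 := by linarith
        exact (mul_eq_zero.1 this).resolve_left ht.ne'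
      simp [h1, h2]
    · rw [mul_div_assoc', le_div_iff₀ h]
      have e : (star x * z).re = x.re * z.re + x.im * z.im := by simp
      rw [e, Complex.normSq_apply, Complex.normSq_apply]
      nlinarith [sq_nonneg (a i * x.re - (b j + t * a i) * z.re),
        sq_nonneg (a i * x.im - (b j + t * a i) * z.im)]
  have hYY : Y * Y = W * diagonal (fun k => ((y k ^ 2 : ℝ) : ℂ)) * Wᴴ := by
    calc Y * Y = W * (D * (Wᴴ * W) * D) * Wᴴ := by simp only [Y, Matrix.mul_assoc]
      _ = _ := by rw [hW, Matrix.mul_one, diagonal_mul_diagonal]; simp [pow_two]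
  have htr : ∀ (X : Matrix n n ℂ) (e x : m → ℝ), (∀ k, (Wᴴ * X * W) k k = x k) →
      (X * (W * diagonal (fun k => (e k : ℂ)) * Wᴴ)).trace = ((∑ k, x k * e k : ℝ) : ℂ) := by
    intro X e x hx
    have : (X * (W * diagonal (fun k => (e k : ℂ)) * Wᴴ)).trace
        = (Wᴴ * X * W * diagonal (fun k => (e k : ℂ))).trace := by
      rw [← Matrix.mul_assoc, Matrix.trace_mul_comm]
      simp only [Matrix.mul_assoc]
    rw [this]
    simp [Matrix.trace, mul_diagonal, hx]
  have h1 : ∑ p : κ × ι, a p.2 * (star ((Vᴴ * U) p.1 p.2) * Z p.1 p.2).re = ∑ k, c k * y k := by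
    have e1 : (A * ((Vᴴ * U)ᴴ * Z)).trace = ((∑ k, c k * y k : ℝ) : ℂ) := by
      rw [← htr (U * A * Uᴴ) y c hac]
      calc (A * ((Vᴴ * U)ᴴ * Z)).trace = (A * Uᴴ * (V * Vᴴ) * Y * U).trace := by
            simp only [Z, conjTranspose_mul, conjTranspose_conjTranspose, Matrix.mul_assoc]
        _ = _ := by
            rw [hV, Matrix.mul_one, Matrix.trace_mul_comm]
            simp only [Y, D, Matrix.mul_assoc]
    rw [← Complex.ofReal_re (∑ k, c k * y k), ← e1, Fintype.sum_prod_type_right]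
    simp only [Matrix.trace, diag_apply, A, diagonal_mul]
    simp only [Matrix.mul_apply (M := (Vᴴ * U)ᴴ), conjTranspose_apply, Complex.re_sum,
      Finset.mul_sum, Complex.re_ofReal_mul]
  have h2 : ∑ p : κ × ι, b p.1 * Complex.normSq (Z p.1 p.2) = ∑ k, d k * y k ^ 2 := by
    have e1 : (B * (Z * Zᴴ)).trace = ((∑ k, d k * y k ^ 2 : ℝ) : ℂ) := by
      rw [← htr (V * B * Vᴴ) (fun k => y k ^ 2) d hbd, ← hYY]
      calc (B * (Z * Zᴴ)).trace = (B * Vᴴ * Y * (U * Uᴴ) * Y * V).trace := by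
            simp only [Z, conjTranspose_mul, conjTranspose_conjTranspose, Matrix.mul_assoc, hY]
        _ = _ := by
            rw [hU, Matrix.mul_one, Matrix.trace_mul_comm]
            simp only [Matrix.mul_assoc]
    rw [← Complex.ofReal_re (∑ k, d k * y k ^ 2), ← e1, Fintype.sum_prod_type]
    simp only [Matrix.trace, diag_apply, B, diagonal_mul]
    simp only [Matrix.mul_apply (N := Zᴴ), conjTranspose_apply, Complex.re_sum,
      Finset.mul_sum, Complex.re_ofReal_mul, Complex.star_def, Complex.mul_conj,
      Complex.ofReal_re]
  have h3 : ∑ p : κ × ι, a p.2 * Complex.normSq (Z p.1 p.2) = ∑ k, c k * y k ^ 2 := by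
    have e1 : (A * (Zᴴ * Z)).trace = ((∑ k, c k * y k ^ 2 : ℝ) : ℂ) := by
      rw [← htr (U * A * Uᴴ) (fun k => y k ^ 2) c hac, ← hYY]
      calc (A * (Zᴴ * Z)).trace = (A * Uᴴ * Y * (V * Vᴴ) * Y * U).trace := by
            simp only [Z, conjTranspose_mul, conjTranspose_conjTranspose, Matrix.mul_assoc, hY]
        _ = _ := by
            rw [hV, Matrix.mul_one, Matrix.trace_mul_comm]
            simp only [Matrix.mul_assoc]
    rw [← Complex.ofReal_re (∑ k, c k * y k ^ 2), ← e1, Fintype.sum_prod_type_right]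
    simp only [Matrix.trace, diag_apply, A, diagonal_mul]
    simp only [Matrix.mul_apply (M := Zᴴ), conjTranspose_apply, Complex.re_sum,
      Finset.mul_sum, Complex.re_ofReal_mul, Complex.star_def, mul_comm _ (Z _ _),
      Complex.mul_conj, Complex.ofReal_re]
  refine le_trans (le_of_eq ?_) (Finset.sum_le_sum fun p _ => hterm p)
  simp only [Finset.sum_sub_distrib, ← Finset.mul_sum]
  rw [h1, h2, h3, Finset.mul_sum, Finset.mul_sum, ← Finset.sum_sub_distrib,
    ← Finset.sum_sub_distrib]
  refine Finset.sum_congr rfl fun k _ => ?_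
  have htc := mul_nonneg ht.le (hc k)
  rcases (add_nonneg (hd k) htc).eq_or_lt with h | h
  · have : y k = 0 := by simp [y, ← h]
    simp [this, ← h]
  · have hy : y k * (d k + t * c k) = c k := div_mul_cancel₀ _ h.ne'
    have hl : c k ^ 2 / (d k + t * c k) = c k * y k := by simp only [y]; ring
    rw [hl]
    linear_combination y k * hy

/-- Monotonicity of the relative entropy under a measurement in an orthonormal basis. -/
lemma relEntropy_measurement_le {n ι κ m : Type*} [Fintype n] [Fintype ι] [Fintype κ]
    [Fintype m] [DecidableEq n] [DecidableEq ι] [DecidableEq κ] [DecidableEq m]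
    (U : Matrix n ι ℂ) (V : Matrix n κ ℂ) (W : Matrix n m ℂ)
    (hU : U * Uᴴ = 1) (hU' : Uᴴ * U = 1) (hV : V * Vᴴ = 1) (hW : Wᴴ * W = 1) (hW' : W * Wᴴ = 1)
    (a : ι → ℝ) (b q : κ → ℝ) (c d : m → ℝ)
    (ha : ∀ k, 0 ≤ a k) (hb : ∀ k, 0 ≤ b k) (hc : ∀ k, 0 ≤ c k) (hd : ∀ k, 0 ≤ d k)
    (hac : ∀ k, (Wᴴ * (U * diagonal (fun i => (a i : ℂ)) * Uᴴ) * W) k k = c k)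
    (hbd : ∀ k, (Wᴴ * (V * diagonal (fun i => (b i : ℂ)) * Vᴴ) * W) k k = d k)
    (haq : ∀ k, (Vᴴ * (U * diagonal (fun i => (a i : ℂ)) * Uᴴ) * V) k k = q k)
    (hbq : ∀ k, b k = 0 → q k = 0) (hdc : ∀ k, d k = 0 → c k = 0) :
    ∑ k, c k * (Real.log (c k) - Real.log (d k)) ≤
      ∑ i, a i * Real.log (a i) - ∑ k, q k * Real.log (b k) := by
  set A : Matrix ι ι ℂ := diagonal (fun i => (a i : ℂ)) with hA
  set w : κ × ι → ℝ := fun p => Complex.normSq ((Vᴴ * U) p.1 p.2) with hw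
  have hwq : ∀ k, ∑ i, w (k, i) * a i = q k := by
    intro k
    have e : Vᴴ * (U * A * Uᴴ) * V = Vᴴ * U * A * (Vᴴ * U)ᴴ := by
      simp only [conjTranspose_mul, conjTranspose_conjTranspose, Matrix.mul_assoc]
    rw [← Complex.ofReal_re (q k), ← haq, e, Matrix.mul_apply, Complex.re_sum]
    refine Finset.sum_congr rfl fun i _ => ?_
    rw [hA, mul_diagonal, conjTranspose_apply, mul_right_comm, Complex.star_def, Complex.mul_conj,
      ← Complex.ofReal_mul, Complex.ofReal_re]
  have hw1 : ∀ i, ∑ k, w (k, i) = 1 := by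
    intro i
    have e : (Vᴴ * U)ᴴ * (Vᴴ * U) = 1 := by
      calc (Vᴴ * U)ᴴ * (Vᴴ * U) = Uᴴ * (V * Vᴴ) * U := by
            simp only [conjTranspose_mul, conjTranspose_conjTranspose, Matrix.mul_assoc]
        _ = 1 := by rw [hV, Matrix.mul_one, hU']
    have e2 := congrArg Complex.re (congrFun (congrFun e i) i)
    rw [Matrix.mul_apply, Complex.re_sum, one_apply_eq, Complex.one_re] at e2
    rw [← e2]
    refine Finset.sum_congr rfl fun k _ => ?_
    rw [conjTranspose_apply, mul_comm, Complex.star_def, Complex.mul_conj, Complex.ofReal_re]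
  have hwa : ∀ f : ι → ℝ, ∑ p : κ × ι, w p * f p.2 = ∑ i, f i := by
    intro f
    rw [Fintype.sum_prod_type_right]
    simp only [← Finset.sum_mul, hw1, one_mul]
  have hsum : ∑ p : κ × ι, w p * a p.2 = ∑ k, c k := by
    rw [hwa]
    have e : (Wᴴ * (U * A * Uᴴ) * W).trace = A.trace := by
      rw [Matrix.trace_mul_comm, ← Matrix.mul_assoc, hW', Matrix.one_mul, Matrix.trace_mul_comm,
        ← Matrix.mul_assoc, hU', Matrix.one_mul]
    simp only [Matrix.trace, diag_apply, hac] at e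
    simp only [hA, diagonal_apply_eq] at e
    exact_mod_cast e.symm
  have hsupp : ∀ p : κ × ι, b p.1 = 0 → w p * a p.2 = 0 := by
    rintro ⟨k, i⟩ hk
    have h0 := (hwq k).trans (hbq k hk)
    exact (Finset.sum_eq_zero_iff_of_nonneg
      fun i _ => mul_nonneg (Complex.normSq_nonneg _) (ha i)).1 h0 i (Finset.mem_univ _)
  have key := sum_mul_log_div_le_of_resolvent_le w (fun p => a p.2) (fun p => b p.1) c d
    (fun _ => ha _) (fun _ => hb _) hc hd hsupp hdc hsum
    (sum_sq_div_le_of_measurement U V W hU hV hW a b c d ha hb hc hd hac hbd)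
  refine key.trans (le_of_eq ?_)
  simp only [mul_sub, Finset.sum_sub_distrib]
  congr 1
  · simp only [mul_assoc]
    exact hwa fun i => a i * Real.log (a i)
  · rw [Fintype.sum_prod_type]
    simp only [← Finset.sum_mul, hwq]

/-- The isometry `u ⊗ I : ℂ² → ℂ²⊗ℂ²⊗ℂ²` attached to a vector `u` of subsystem AB. -/
def embAB (u : Q4 → ℂ) : Matrix Q3 Q2 ℂ :=
  fun x c => u (x.1, x.2.1) * (if x.2.2 = c then (1 : ℂ) else 0)

lemma conjTranspose_embAB_mul_embAB (u w : Q4 → ℂ) :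
    (embAB u)ᴴ * embAB w = (∑ k, star (u k) * w k) • (1 : Matrix Q2 Q2 ℂ) := by
  ext c c'
  simp only [Matrix.mul_apply, conjTranspose_apply, embAB, Fintype.sum_prod_type,
    Matrix.smul_apply,
    one_apply, smul_eq_mul, Finset.sum_mul]
  refine Finset.sum_congr rfl fun x _ => Finset.sum_congr rfl fun y _ => ?_
  rcases eq_or_ne c c' with h | h
  · simp [h]
  · simp [h, h.symm]

lemma opAB_proj (u : Q4 → ℂ) : opAB (proj u) = embAB u * (embAB u)ᴴ := by
  ext x y
  simp only [Matrix.mul_apply, conjTranspose_apply, embAB, opAB, proj]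
  rcases eq_or_ne x.2.2 y.2.2 with h | h
  · simp [h]
  · simp [h, h.symm]

lemma rhoC_embAB (u : Q4 → ℂ) (M : Matrix Q2 Q2 ℂ) :
    rhoC (embAB u * M * (embAB u)ᴴ) = (∑ k, star (u k) * u k) • M := by
  ext c c'
  simp only [rhoC, Matrix.mul_apply, conjTranspose_apply, embAB, Fintype.sum_prod_type,
    Matrix.smul_apply,
    smul_eq_mul, Finset.sum_mul]
  refine Finset.sum_congr rfl fun x _ => Finset.sum_congr rfl fun y _ => ?_
  fin_cases c <;> fin_cases c' <;> simp <;> ring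

lemma trace_embAB_rhoAB (u : Q4 → ℂ) (ρ : Matrix Q3 Q3 ℂ) :
    ((embAB u)ᴴ * ρ * embAB u).trace = star u ⬝ᵥ (rhoAB ρ *ᵥ u) := by
  simp [Matrix.trace, Matrix.mul_apply, embAB, rhoAB, dotProduct, mulVec, Fintype.sum_prod_type,
    Fin.sum_univ_two]
  ring

lemma embAB_opAB (u : Q4 → ℂ) (X : Matrix Q4 Q4 ℂ) :
    (embAB u)ᴴ * opAB X * embAB u = (star u ⬝ᵥ (X *ᵥ u)) • (1 : Matrix Q2 Q2 ℂ) := by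
  ext c c'
  fin_cases c <;> fin_cases c' <;>
    simp [Matrix.mul_apply, embAB, opAB, dotProduct, mulVec, Fintype.sum_prod_type,
    Fin.sum_univ_two] <;>
    ring

/-- The matrix whose column block at `i` is `E i`. -/
def blockRow {n ι κ : Type*} (E : ι → Matrix n κ ℂ) : Matrix n (ι × κ) ℂ := fun x p => E p.1 x p.2

lemma blockRow_conj_apply {n ι κ : Type*} [Fintype n] (E : ι → Matrix n κ ℂ) (X : Matrix n n ℂ)
    (p q : ι × κ) :
    ((blockRow E)ᴴ * X * blockRow E) p q = ((E p.1)ᴴ * X * E q.1) p.2 q.2 := by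
  simp only [Matrix.mul_apply, conjTranspose_apply, blockRow]

lemma conjTranspose_blockRow_mul_self {n ι κ : Type*} [Fintype n] [DecidableEq n] [DecidableEq ι]
    [DecidableEq κ] (E : ι → Matrix n κ ℂ)
    (hE : ∀ i j, (E i)ᴴ * E j = if i = j then 1 else 0) : (blockRow E)ᴴ * blockRow E = 1 := by
  ext p q
  have h := blockRow_conj_apply E 1 p q
  rw [Matrix.mul_one, Matrix.mul_one, hE] at h
  rw [h, one_apply]
  rcases p with ⟨i, k⟩
  rcases q with ⟨j, l⟩
  by_cases hij : i = j <;> simp [hij, one_apply]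

lemma blockRow_embAB_diagonal (F : Matrix Q4 Q4 ℂ) (μ : Q4 → ℂ) :
    blockRow (fun i => embAB fun x => F x i) *
      (diagonal (fun p => μ p.1) : Matrix (Q4 × Q2) (Q4 × Q2) ℂ) *
      (blockRow (fun i => embAB fun x => F x i))ᴴ = opAB (F * diagonal μ * Fᴴ) := by
  ext x y
  rw [Matrix.mul_apply, Fintype.sum_prod_type]
  simp only [opAB, mul_diagonal, conjTranspose_apply, blockRow, embAB, Matrix.mul_apply (N := Fᴴ),
    Finset.sum_mul]
  refine Finset.sum_congr rfl fun i _ => ?_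
  rcases eq_or_ne x.2.2 y.2.2 with h | h
  · simp [h]
  · simp [h, h.symm]

lemma posSemidef_rhoAB {ρ : Matrix Q3 Q3 ℂ} (hρ : ρ.PosSemidef) : (rhoAB ρ).PosSemidef := by
  have h : rhoAB ρ = ∑ c : Q2, ρ.submatrix (fun x : Q4 => (x.1, x.2, c))
      (fun x : Q4 => (x.1, x.2, c)) := by
    ext x y
    simp [rhoAB, Matrix.sum_apply]
  rw [h]
  exact Matrix.posSemidef_sum _ fun c _ => hρ.submatrix _

lemma isHermitian_exists_diagonalization {n : Type*} [Fintype n] [DecidableEq n]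
    {A : Matrix n n ℂ} (hA : A.IsHermitian) : ∃ U : Matrix n n ℂ, U * Uᴴ = 1 ∧ Uᴴ * U = 1 ∧
      U * diagonal (fun i => (hA.eigenvalues i : ℂ)) * Uᴴ = A := by
  refine ⟨hA.eigenvectorUnitary, ?_, ?_, ?_⟩
  · exact Unitary.coe_mul_star_self hA.eigenvectorUnitary
  · exact Unitary.coe_star_mul_self hA.eigenvectorUnitary
  · conv_rhs => rw [hA.spectral_theorem, Unitary.conjStarAlgAut_apply]
    rfl

lemma conj_diagonalization {n : Type*} [Fintype n] [DecidableEq n] {A U : Matrix n n ℂ}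
    {a : n → ℝ} (hU : Uᴴ * U = 1) (h : U * diagonal (fun i => (a i : ℂ)) * Uᴴ = A) :
    Uᴴ * A * U = diagonal (fun i => (a i : ℂ)) := by
  rw [← h]
  calc Uᴴ * (U * diagonal (fun i => (a i : ℂ)) * Uᴴ) * U
      = (Uᴴ * U) * diagonal (fun i => (a i : ℂ)) * (Uᴴ * U) := by simp only [Matrix.mul_assoc]
    _ = _ := by rw [hU, Matrix.one_mul, Matrix.mul_one]

lemma posSemidef_conj_embAB {ρ : Matrix Q3 Q3 ℂ} (hρ : ρ.PosSemidef) (u : Q4 → ℂ) :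
    ((embAB u)ᴴ * ρ * embAB u).PosSemidef := hρ.conjTranspose_mul_mul_same _

lemma trace_conj_embAB_eq_pAB {ρ : Matrix Q3 Q3 ℂ} (hρ : ρ.PosSemidef) (v : Fin 4 → Q4 → ℂ)
    (j : Fin 4) : ((embAB (v j))ᴴ * ρ * embAB (v j)).trace = (pAB ρ v j : ℂ) := by
  have h0 : (pAB ρ v j) = ((embAB (v j))ᴴ * ρ * embAB (v j)).trace.re := by
    rw [pAB, opAB_proj, Matrix.mul_assoc, Matrix.trace_mul_comm]
  have h1 := (posSemidef_conj_embAB hρ (v j)).trace_nonneg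
  rw [Complex.nonneg_iff] at h1
  apply Complex.ext
  · simp [h0]
  · simp [← h1.2]

lemma pAB_nonneg {ρ : Matrix Q3 Q3 ℂ} (hρ : ρ.PosSemidef) (v : Fin 4 → Q4 → ℂ)
    (j : Fin 4) : 0 ≤ pAB ρ v j := by
  have h1 := (posSemidef_conj_embAB hρ (v j)).trace_nonneg
  rw [trace_conj_embAB_eq_pAB hρ] at h1
  exact_mod_cast h1

lemma condC_eq (ρ : Matrix Q3 Q3 ℂ) {v : Fin 4 → Q4 → ℂ} (hv : OrthonormalFamily v) (j : Fin 4) :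
    condC ρ v j = (pAB ρ v j : ℂ)⁻¹ • ((embAB (v j))ᴴ * ρ * embAB (v j)) := by
  have h : opAB (proj (v j)) * ρ * opAB (proj (v j))
      = embAB (v j) * ((embAB (v j))ᴴ * ρ * embAB (v j)) * (embAB (v j))ᴴ := by
    simp only [opAB_proj, Matrix.mul_assoc]
  rw [condC, h, rhoC_embAB, hv, if_pos rfl, one_smul]

lemma pAB_smul_condC {ρ : Matrix Q3 Q3 ℂ} (hρ : ρ.PosSemidef) {v : Fin 4 → Q4 → ℂ}
    (hv : OrthonormalFamily v) (j : Fin 4) :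
    (embAB (v j))ᴴ * ρ * embAB (v j) = (pAB ρ v j : ℂ) • condC ρ v j := by
  rw [condC_eq ρ hv]
  rcases eq_or_ne (pAB ρ v j) 0 with h | h
  · have := trace_conj_embAB_eq_pAB hρ v j
    rw [h, Complex.ofReal_zero, (posSemidef_conj_embAB hρ (v j)).trace_eq_zero_iff] at this
    simp [this]
  · rw [smul_inv_smul₀ (by exact_mod_cast h)]

lemma posSemidef_condC {ρ : Matrix Q3 Q3 ℂ} (hρ : ρ.PosSemidef) {v : Fin 4 → Q4 → ℂ}
    (hv : OrthonormalFamily v) (j : Fin 4) : (condC ρ v j).PosSemidef := by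
  rw [condC_eq ρ hv]
  refine (posSemidef_conj_embAB hρ (v j)).smul ?_
  have := inv_nonneg.2 (pAB_nonneg hρ v j)
  exact_mod_cast this

/-- For a three-qubit density matrix and a rank-one projective measurement on AB,
the change in the merging cost is nonnegative:
`Δ₂ = S(ρ_{C|Π^{AB}}) − (S(ρ_ABC) − S(ρ_AB)) ≥ 0`. -/
theorem two_particle_measurement_increases_conditional_entropy
    (ρ : Matrix Q3 Q3 ℂ) (hρ : IsDensityMatrix ρ)
    (v : Fin 4 → Q4 → ℂ) (hv : OrthonormalFamily v) :
    0 ≤ SCcondAB ρ v - (vN ρ - vN (rhoAB ρ)) := by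
  have hpsd := hρ.1
  have hAB := posSemidef_rhoAB hpsd
  have hC := posSemidef_condC hpsd hv
  obtain ⟨U, hU, hU', hUρ⟩ := isHermitian_exists_diagonalization hpsd.isHermitian
  obtain ⟨F, hF, hF', hFρ⟩ := isHermitian_exists_diagonalization hAB.isHermitian
  choose G hG hG' hGρ using fun j => isHermitian_exists_diagonalization (hC j).isHermitian
  set a := hpsd.isHermitian.eigenvalues
  set μ := hAB.isHermitian.eigenvalues
  set κ : Fin 4 → Q2 → ℝ := fun j => (hC j).isHermitian.eigenvalues
  have hμ : ∀ i, 0 ≤ μ i := hAB.eigenvalues_nonneg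
  have hκ : ∀ j k, 0 ≤ κ j k := fun j => (hC j).eigenvalues_nonneg
  have hp := pAB_nonneg hpsd v
  set V := blockRow (fun i => embAB fun x => F x i) with hVdef
  set W := blockRow (fun j => embAB (v j) * G j) with hWdef
  have hV' : Vᴴ * V = 1 := by
    refine conjTranspose_blockRow_mul_self _ fun i j => ?_
    have h := congrFun (congrFun hF' i) j
    simp only [Matrix.mul_apply, conjTranspose_apply] at h
    rw [conjTranspose_embAB_mul_embAB, h, one_apply]
    split_ifs <;> simp
  have hW : Wᴴ * W = 1 := by
    refine conjTranspose_blockRow_mul_self _ fun i j => ?_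
    calc (embAB (v i) * G i)ᴴ * (embAB (v j) * G j)
        = (G i)ᴴ * ((embAB (v i))ᴴ * embAB (v j)) * G j := by
          simp only [conjTranspose_mul, Matrix.mul_assoc]
      _ = _ := by
          rw [conjTranspose_embAB_mul_embAB, hv]
          split_ifs with h
          · subst h; simp [hG']
          · simp
  have hV : V * Vᴴ = 1 := (Matrix.mul_eq_one_comm_of_card_eq _ _ _ (by simp)).1 hV'
  have hW' : W * Wᴴ = 1 := (Matrix.mul_eq_one_comm_of_card_eq _ _ _ (by simp)).1 hW
  have hWconj : ∀ (X : Matrix Q3 Q3 ℂ) (r : Fin 4 × Q2), (Wᴴ * X * W) r r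
      = ((G r.1)ᴴ * ((embAB (v r.1))ᴴ * X * embAB (v r.1)) * G r.1) r.2 r.2 := by
    intro X r
    rw [blockRow_conj_apply, conjTranspose_mul]
    simp only [Matrix.mul_assoc]
  have hac : ∀ r : Fin 4 × Q2, (Wᴴ * ρ * W) r r = ((pAB ρ v r.1 * κ r.1 r.2 : ℝ) : ℂ) := by
    intro r
    rw [hWconj, pAB_smul_condC hpsd hv, Matrix.mul_smul, Matrix.smul_mul,
      conj_diagonalization (hG' _) (hGρ _)]
    simp [κ]
  have hbd : ∀ r : Fin 4 × Q2, (Wᴴ * opAB (rhoAB ρ) * W) r r = (pAB ρ v r.1 : ℂ) := by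
    intro r
    rw [hWconj, embAB_opAB, ← trace_embAB_rhoAB, trace_conj_embAB_eq_pAB hpsd, Matrix.mul_smul,
      Matrix.smul_mul, Matrix.mul_one, hG']
    simp
  have hq0 : ∀ r, 0 ≤ (Vᴴ * ρ * V) r r := fun r =>
    (hpsd.conjTranspose_mul_mul_same V).diag_nonneg
  set q : Q4 × Q2 → ℝ := fun r => ((Vᴴ * ρ * V) r r).re
  have hq : ∀ r, (Vᴴ * ρ * V) r r = (q r : ℂ) := fun r =>
    Complex.ext (by simp [q]) (by simp [← (Complex.nonneg_iff.1 (hq0 r)).2])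
  have hqnn : ∀ r, 0 ≤ q r := fun r => (Complex.nonneg_iff.1 (hq0 r)).1
  have hqsum : ∀ i, ∑ c, q (i, c) = μ i := by
    intro i
    have h1 := congrFun (congrFun (conj_diagonalization hF' hFρ) i) i
    rw [diagonal_apply_eq] at h1
    have h2 := trace_embAB_rhoAB (fun x => F x i) ρ
    have h3 : (star fun x => F x i) ⬝ᵥ (rhoAB ρ *ᵥ fun x => F x i) = (Fᴴ * rhoAB ρ * F) i i := by
      rw [Matrix.mul_assoc]
      rfl
    rw [h3, h1] at h2
    have h4 := congrArg Complex.re h2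
    rw [Matrix.trace, Complex.re_sum, Complex.ofReal_re] at h4
    rw [← h4]
    refine Finset.sum_congr rfl fun c _ => ?_
    simp only [q, hVdef, blockRow_conj_apply, diag_apply]
  have key := relEntropy_measurement_le U V W hU hU' hV hW hW' a (fun r => μ r.1) q
    (fun r => pAB ρ v r.1 * κ r.1 r.2) (fun r => pAB ρ v r.1) hpsd.eigenvalues_nonneg
    (fun _ => hμ _) (fun _ => mul_nonneg (hp _) (hκ _ _)) (fun _ => hp _)
    (by rw [hUρ]; exact hac)
    (by rw [hVdef, blockRow_embAB_diagonal F (fun i => (μ i : ℂ)), hFρ]; exact hbd)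
    (by rw [hUρ]; exact hq)
    (fun r hr => (Finset.sum_eq_zero_iff_of_nonneg fun c _ => hqnn (r.1, c)).1
      ((hqsum r.1).trans hr) r.2 (Finset.mem_univ _))
    (fun r hr => by simp only [hr, zero_mul])
  have e1 : vN ρ = -∑ i, a i * Real.log (a i) := by
    rw [vN, dif_pos hpsd.isHermitian, ← Finset.sum_neg_distrib]
    simp [Real.negMulLog, a]
  have e2 : vN (rhoAB ρ) = -∑ r, q r * Real.log (μ r.1) := by
    rw [vN, dif_pos hAB.isHermitian, Fintype.sum_prod_type (f := fun r => q r * _),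
      ← Finset.sum_neg_distrib]
    simp only [← Finset.sum_mul, hqsum, Real.negMulLog, neg_mul, μ]
  have e3 : SCcondAB ρ v = -∑ r : Fin 4 × Q2, pAB ρ v r.1 * κ r.1 r.2 *
      (Real.log (pAB ρ v r.1 * κ r.1 r.2) - Real.log (pAB ρ v r.1)) := by
    rw [SCcondAB, Fintype.sum_prod_type, ← Finset.sum_neg_distrib]
    refine Finset.sum_congr rfl fun j _ => ?_
    split_ifs with h
    · rw [vN, dif_pos (hC j).isHermitian, Finset.mul_sum, ← Finset.sum_neg_distrib]
      refine Finset.sum_congr rfl fun k _ => ?_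
      change pAB ρ v j * Real.negMulLog (κ j k) = _
      rcases eq_or_ne (κ j k) 0 with hk | hk
      · simp [hk]
      · rw [Real.log_mul h.ne' hk, Real.negMulLog]
        ring
    · have h0 : pAB ρ v j = 0 := le_antisymm (not_lt.1 h) (hp j)
      simp [h0]
  rw [e1, e2, e3]
  linarith
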